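/- arXiv:1105.1229 — 9 statements merged into one kernel-verified Lean document; each statement's English description precedes it below -/
import Mathlib

section
/- Let Λ be a K-linear functional on R = K[x₁,…,xₙ] such that the Hankel operator H_Λ has finite rank r, and let b₁,…,b_r ∈ R be such that the r×r matrix (Λ(b_i·b_j))_{1≤i,j≤r} is invertible. Then R decomposes as a direct sum of K-vector spaces R = span{b₁,…,b_r} ⊕ I_Λ. -/
open MvPolynomial

/-- The Hankel operator `H_Λ : R →ₗ[K] R*`, `p ↦ (q ↦ Λ(p·q))`. -/
noncomputable def hankel {K : Type*} [Field K] {n : ℕ}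
    (Λ : MvPolynomial (Fin n) K →ₗ[K] K) :
    MvPolynomial (Fin n) K →ₗ[K] (MvPolynomial (Fin n) K →ₗ[K] K) :=
  (LinearMap.llcomp K (MvPolynomial (Fin n) K) (MvPolynomial (Fin n) K) K Λ).comp
    (LinearMap.mul K (MvPolynomial (Fin n) K))

theorem isCompl_aux {K V W : Type*} [Field K] [AddCommGroup V] [Module K V] [AddCommGroup W]
    [Module K W] {r : ℕ} (f : V →ₗ[K] W)
    (hfin : Module.Finite K (LinearMap.range f))
    (hrank : Module.finrank K (LinearMap.range f) = r) (b : Fin r → V)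
    (key : ∀ c : Fin r → K, f (∑ i, c i • b i) = 0 → c = 0) :
    IsCompl (Submodule.span K (Set.range b)) (LinearMap.ker f) := by
  have hli : LinearIndependent K
      (fun i => (⟨f (b i), LinearMap.mem_range_self _ _⟩ : LinearMap.range f)) := by
    rw [Fintype.linearIndependent_iff]
    intro c hc
    have h := congrArg Subtype.val hc
    have h1 := key c (by simpa using h)
    intro i
    exact congrFun h1 i
  have hspan := hli.span_eq_top_of_card_eq_finrank' (by simp [hrank])
  constructor
  · rw [Submodule.disjoint_def]
    intro p hp hk
    obtain ⟨c, rfl⟩ := (Submodule.mem_span_range_iff_exists_fun K).1 hp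
    have h1 := key c hk
    simp [h1]
  · rw [codisjoint_iff, eq_top_iff]
    intro p _
    have hm : (⟨f p, LinearMap.mem_range_self _ _⟩ : LinearMap.range f) ∈
        (⊤ : Submodule K (LinearMap.range f)) := trivial
    rw [← hspan] at hm
    obtain ⟨c, hc⟩ := (Submodule.mem_span_range_iff_exists_fun K).1 hm
    have h := congrArg Subtype.val hc
    refine Submodule.mem_sup.2 ⟨∑ i, c i • b i,
      (Submodule.mem_span_range_iff_exists_fun K).2 ⟨c, rfl⟩, p - ∑ i, c i • b i, ?_, by abel⟩
    rw [LinearMap.mem_ker, map_sub, sub_eq_zero]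
    simpa using h.symm

/-- If H_Λ has finite rank r and the matrix (Λ(bᵢ·bⱼ)) is invertible,
then R = span{b₁,…,b_r} ⊕ I_Λ as K-vector spaces. -/
theorem span_isCompl_hankel_kernel {K : Type*} [Field K] {n r : ℕ}
    (Λ : MvPolynomial (Fin n) K →ₗ[K] K)
    (hfin : Module.Finite K (LinearMap.range (hankel Λ)))
    (hrank : Module.finrank K (LinearMap.range (hankel Λ)) = r)
    (b : Fin r → MvPolynomial (Fin n) K)
    (hH : IsUnit ((Matrix.of fun i j => Λ (b i * b j)) : Matrix (Fin r) (Fin r) K)) :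
    IsCompl (Submodule.span K (Set.range b)) (LinearMap.ker (hankel Λ)) := by
  have key : ∀ c : Fin r → K, hankel Λ (∑ i, c i • b i) = 0 → c = 0 := by
    intro c hc
    have h0 : Matrix.vecMul c (Matrix.of fun i j => Λ (b i * b j)) = 0 := by
      funext j
      have h := LinearMap.congr_fun hc (b j)
      simpa [hankel, Matrix.vecMul, dotProduct, Finset.sum_mul] using h
    exact Matrix.vecMul_injective_of_isUnit hH (by simpa using h0)
  exact isCompl_aux (hankel Λ) hfin hrank b key
end

section
/- Let Λ be a K-linear functional on R = K[x₁,…,xₙ] such that the Hankel operator H_Λ has finite rank r, and let B = {b₁,…,b_r} ⊂ R be such that the matrix (Λ(b_i·b_j))_{1≤i,j≤r} is invertible and 1 lies in the span of B. Then the ideal I_Λ is generated by the elements of I_Λ lying in the span of B⁺ = B ∪ x₁B ∪ ⋯ ∪ xₙB; that is, I_Λ = (I_Λ ∩ span(B⁺)) as an ideal. -/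
open MvPolynomial

/-- The kernel `I_Λ = {p : ∀ q, Λ(p·q) = 0}` of the Hankel operator, as an ideal of R. -/
noncomputable def hankelIdeal {K : Type*} [Field K] {n : ℕ}
    (Λ : MvPolynomial (Fin n) K →ₗ[K] K) : Ideal (MvPolynomial (Fin n) K) where
  carrier := {p | ∀ q, Λ (p * q) = 0}
  add_mem' := by
    intro a b ha hb q
    simp [add_mul, map_add, ha q, hb q]
  zero_mem' := by intro q; simp
  smul_mem' := by
    intro c p hp q
    have := hp (c * q)
    simpa [smul_eq_mul, mul_assoc, mul_comm, mul_left_comm] using this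

theorem exists_comb_of_rank {K V W : Type*} [Field K] [AddCommGroup V] [Module K V]
    [AddCommGroup W] [Module K W] (f : V →ₗ[K] W) {r : ℕ}
    (hfin : Module.Finite K (LinearMap.range f))
    (hrank : Module.finrank K (LinearMap.range f) = r) (b : Fin r → V)
    (hb : ∀ c : Fin r → K, f (∑ i, c i • b i) = 0 → c = 0) (p : V) :
    ∃ c : Fin r → K, f (∑ i, c i • b i) = f p := by
  let g : Fin r → LinearMap.range f := fun i => ⟨f (b i), b i, rfl⟩
  have hg : LinearIndependent K g := by
    rw [Fintype.linearIndependent_iff]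
    intro c hc
    have : c = 0 := by
      apply hb
      have h2 := congrArg Subtype.val hc
      simpa [g, map_sum] using h2
    intro i; simp [this]
  have htop := hg.span_eq_top_of_card_eq_finrank' (by simp [hrank])
  have hm : (⟨f p, p, rfl⟩ : LinearMap.range f) ∈
      Submodule.span K (Set.range g) := by rw [htop]; trivial
  obtain ⟨c, hc⟩ := (Submodule.mem_span_range_iff_exists_fun K).1 hm
  refine ⟨c, ?_⟩
  have h2 := congrArg Subtype.val hc
  simpa [g, map_sum] using h2

/-- If H_Λ has finite rank r, the matrix (Λ(bᵢ·bⱼ)) is invertible and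
1 ∈ span B, then I_Λ is generated (as an ideal) by I_Λ ∩ span(B⁺), where
B⁺ = B ∪ x₁B ∪ ⋯ ∪ xₙB. -/
theorem hankel_kernel_generated_in_Bplus {K : Type*} [Field K] {n r : ℕ}
    (Λ : MvPolynomial (Fin n) K →ₗ[K] K)
    (hfin : Module.Finite K (LinearMap.range (hankel Λ)))
    (hrank : Module.finrank K (LinearMap.range (hankel Λ)) = r)
    (b : Fin r → MvPolynomial (Fin n) K)
    (hH : IsUnit ((Matrix.of fun i j => Λ (b i * b j)) : Matrix (Fin r) (Fin r) K))
    (h1 : (1 : MvPolynomial (Fin n) K) ∈ Submodule.span K (Set.range b)) :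
    hankelIdeal Λ = Ideal.span
      ((hankelIdeal Λ : Set (MvPolynomial (Fin n) K)) ∩
        (Submodule.span K
          (Set.range b ∪ ⋃ i : Fin n, (fun p => X i * p) '' Set.range b) :
          Submodule K (MvPolynomial (Fin n) K))) := by
  have hI : ∀ p, p ∈ hankelIdeal Λ ↔ ∀ q, Λ (p * q) = 0 := fun p => Iff.rfl
  have hap : ∀ p q, hankel Λ p q = Λ (p * q) := fun p q => rfl
  have key : ∀ c : Fin r → K, (∀ j, Λ ((∑ i, c i • b i) * b j) = 0) → c = 0 := by
    intro c hc
    have h0 : Matrix.vecMul c (Matrix.of fun i j => Λ (b i * b j)) = 0 := by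
      funext j
      have := hc j
      simpa [Matrix.vecMul, dotProduct, Finset.sum_mul, map_sum] using this
    apply Matrix.vecMul_injective_of_isUnit hH
    simpa using h0
  have c2 : ∀ v ∈ Submodule.span K (Set.range b), v ∈ hankelIdeal Λ → v = 0 := by
    intro v hv hvI
    obtain ⟨c, rfl⟩ := (Submodule.mem_span_range_iff_exists_fun K).1 hv
    have := key c (fun j => (hI _).1 hvI _)
    simp [this]
  have c1 : ∀ p, ∃ v ∈ Submodule.span K (Set.range b), p - v ∈ hankelIdeal Λ := by
    intro p
    obtain ⟨c, h3⟩ := exists_comb_of_rank (hankel Λ) hfin hrank b (by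
      intro c hc
      apply key
      intro j
      rw [← hap, hc]; rfl) p
    refine ⟨∑ i, c i • b i, (Submodule.mem_span_range_iff_exists_fun K).2 ⟨c, rfl⟩, ?_⟩
    rw [hI]
    intro q
    rw [← hap, map_sub, h3, sub_self]; rfl
  apply le_antisymm
  · set S := Submodule.span K
          (Set.range b ∪ ⋃ i : Fin n, (fun p => X i * p) '' Set.range b) with hS
    set J := Ideal.span ((hankelIdeal Λ : Set (MvPolynomial (Fin n) K)) ∩ S) with hJ
    have hJI : J ≤ hankelIdeal Λ := Ideal.span_le.2 Set.inter_subset_left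
    have hVS : Submodule.span K (Set.range b) ≤ S :=
      Submodule.span_mono Set.subset_union_left
    have hXS : ∀ i, ∀ v ∈ Submodule.span K (Set.range b), X i * v ∈ S := by
      intro i v hv
      have : Submodule.span K (Set.range b) ≤ S.comap (LinearMap.mulLeft K (X i)) := by
        rw [Submodule.span_le]
        intro w hw
        apply Submodule.subset_span
        exact Or.inr (Set.mem_iUnion.2 ⟨i, w, hw, rfl⟩)
      exact this hv
    have c3 : ∀ p, ∃ v ∈ Submodule.span K (Set.range b), p - v ∈ J := by
      intro p
      induction p using MvPolynomial.induction_on with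
      | C a =>
        refine ⟨C a, ?_, by simp⟩
        rw [C_eq_smul_one]
        exact Submodule.smul_mem _ _ h1
      | add p q hp hq =>
        obtain ⟨v, hv, hv'⟩ := hp
        obtain ⟨w, hw, hw'⟩ := hq
        refine ⟨v + w, add_mem hv hw, ?_⟩
        rw [add_sub_add_comm]
        exact add_mem hv' hw'
      | mul_X p i hp =>
        obtain ⟨v, hv, hv'⟩ := hp
        obtain ⟨w, hw, hw'⟩ := c1 (X i * v)
        refine ⟨w, hw, ?_⟩
        have e : p * X i - w = X i * (p - v) + (X i * v - w) := by ring
        rw [e]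
        exact add_mem (J.mul_mem_left _ hv')
          (Ideal.subset_span ⟨hw', sub_mem (hXS i v hv) (hVS hw)⟩)
    intro p hp
    obtain ⟨v, hv, hv'⟩ := c3 p
    have hvI : v ∈ hankelIdeal Λ := by
      have := sub_mem hp (hJI hv')
      simpa using this
    have := c2 v hv hvI
    simpa [this] using hv'
  · exact Ideal.span_le.2 Set.inter_subset_left
end

section
/- Let Λ be a K-linear functional on R = K[x₁,…,xₙ] such that the Hankel operator H_Λ has finite rank r. Then the quotient algebra A_Λ = R/I_Λ has K-dimension r, and the set of common zeros in Kⁿ of the ideal I_Λ has at most r elements. -/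
open MvPolynomial

/-- If H_Λ has finite rank r, then dim_K (R/I_Λ) = r and the set of
common zeros of I_Λ in Kⁿ is finite with at most r elements. -/
theorem quotient_dim_and_zeros {K : Type*} [Field K] {n r : ℕ}
    (Λ : MvPolynomial (Fin n) K →ₗ[K] K)
    (hfin : Module.Finite K (LinearMap.range (hankel Λ)))
    (hrank : Module.finrank K (LinearMap.range (hankel Λ)) = r) :
    Module.finrank K (MvPolynomial (Fin n) K ⧸ hankelIdeal Λ) = r ∧
    {ζ : Fin n → K | ∀ p ∈ hankelIdeal Λ, eval ζ p = 0}.Finite ∧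
    {ζ : Fin n → K | ∀ p ∈ hankelIdeal Λ, eval ζ p = 0}.ncard ≤ r := by
  classical
  have hker : LinearMap.ker (hankel Λ) = (hankelIdeal Λ).restrictScalars K := by
    ext p
    rw [LinearMap.mem_ker, LinearMap.ext_iff]
    rfl
  let e : (MvPolynomial (Fin n) K ⧸ hankelIdeal Λ) ≃ₗ[K] LinearMap.range (hankel Λ) :=
    (Submodule.Quotient.restrictScalarsEquiv K (hankelIdeal Λ)).symm.trans
      ((Submodule.quotEquivOfEq _ _ hker.symm).trans (hankel Λ).quotKerEquivRange)
  have hA : Module.Finite K (MvPolynomial (Fin n) K ⧸ hankelIdeal Λ) :=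
    Module.Finite.equiv e.symm
  have hd : Module.finrank K (MvPolynomial (Fin n) K ⧸ hankelIdeal Λ) = r :=
    e.finrank_eq.trans hrank
  let S := {ζ : Fin n → K | ∀ p ∈ hankelIdeal Λ, eval ζ p = 0}
  let φ : S → ((MvPolynomial (Fin n) K ⧸ hankelIdeal Λ) →ₐ[K] K) := fun ζ =>
    Ideal.Quotient.liftₐ (hankelIdeal Λ) (aeval ζ.1) (fun p hp => by
      rw [MvPolynomial.aeval_eq_eval]; exact ζ.2 p hp)
  have hφ : Function.Injective φ := by
    intro a b hab
    ext i
    have h := DFunLike.congr_fun hab (Ideal.Quotient.mk _ (X i))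
    simpa [φ] using h
  have hli := (linearIndependent_algHom_toLinearMap K
    (MvPolynomial (Fin n) K ⧸ hankelIdeal Λ) K).comp φ hφ
  have hSf : Finite S := hli.finite
  have := Fintype.ofFinite S
  refine ⟨hd, Set.toFinite S, ?_⟩
  have hc := hli.fintype_card_le_finrank
  have h2 : Module.finrank K ((MvPolynomial (Fin n) K ⧸ hankelIdeal Λ) →ₗ[K] K) = r :=
    Subspace.dual_finrank_eq.trans hd
  rw [h2] at hc
  change S.ncard ≤ r
  rwa [← Nat.card_coe_set_eq, Nat.card_eq_fintype_card]
end

section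
/- Let ζ₁,…,ζ_r be distinct points of Kⁿ, γ₁,…,γ_r ∈ K nonzero scalars, and let Λ = Σ_{i=1}^r γ_i·1_{ζ_i} be the corresponding linear functional on R = K[x₁,…,xₙ]. Then I_Λ equals the vanishing ideal of the finite set {ζ₁,…,ζ_r} (in particular I_Λ is a radical ideal), and the Hankel operator H_Λ has rank exactly r. -/
open MvPolynomial

/-- The vanishing ideal of a set S ⊆ Kⁿ. -/
noncomputable def vanishIdeal {K : Type*} [Field K] {n : ℕ}
    (S : Set (Fin n → K)) : Ideal (MvPolynomial (Fin n) K) where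
  carrier := {p | ∀ ζ ∈ S, eval ζ p = 0}
  add_mem' := by
    intro a b ha hb ζ hζ
    simp [ha ζ hζ, hb ζ hζ]
  zero_mem' := by intro ζ hζ; simp
  smul_mem' := by
    intro c p hp ζ hζ
    simp [smul_eq_mul, hp ζ hζ]

theorem exists_interp {K : Type*} [Field K] {n r : ℕ}
    (ζ : Fin r → (Fin n → K)) (hζ : Function.Injective ζ) (i : Fin r) :
    ∃ p : MvPolynomial (Fin n) K, ∀ j, eval (ζ j) p = if j = i then 1 else 0 := by
  classical
  have h : ∀ j, ∃ p : MvPolynomial (Fin n) K, eval (ζ i) p = 1 ∧ (j ≠ i → eval (ζ j) p = 0) := by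
    intro j
    by_cases hj : j = i
    · exact ⟨1, by simp, fun h => absurd hj h⟩
    · obtain ⟨k, hk⟩ := Function.ne_iff.mp (fun h => hj (hζ h) : ζ j ≠ ζ i)
      refine ⟨C ((ζ i k - ζ j k)⁻¹) * (X k - C (ζ j k)), ?_, ?_⟩
      · have : ζ i k - ζ j k ≠ 0 := sub_ne_zero.mpr (Ne.symm hk)
        simp [this]
      · intro _
        simp
  choose p h1 h0 using h
  refine ⟨∏ j, p j, fun j => ?_⟩
  rw [map_prod]
  split_ifs with hj
  · subst hj
    exact Finset.prod_eq_one fun k _ => h1 k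
  · exact Finset.prod_eq_zero (Finset.mem_univ j) (h0 j hj)

/-- If Λ = Σ γᵢ·1_{ζᵢ} with distinct points ζᵢ and nonzero γᵢ, then
I_Λ is the vanishing ideal of {ζ₁,…,ζ_r} (in particular radical) and
rank H_Λ = r. -/
theorem hankel_of_evaluations {K : Type*} [Field K] {n r : ℕ}
    (ζ : Fin r → (Fin n → K)) (hζ : Function.Injective ζ)
    (γ : Fin r → K) (hγ : ∀ i, γ i ≠ 0)
    (Λ : MvPolynomial (Fin n) K →ₗ[K] K)
    (hΛ : Λ = ∑ i, γ i • (MvPolynomial.aeval (ζ i) :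
        MvPolynomial (Fin n) K →ₐ[K] K).toLinearMap) :
    hankelIdeal Λ = vanishIdeal (Set.range ζ) ∧
    (hankelIdeal Λ).IsRadical ∧
    Module.Finite K (LinearMap.range (hankel Λ)) ∧
    Module.finrank K (LinearMap.range (hankel Λ)) = r := by
  classical
  have hL : ∀ p, Λ p = ∑ i, γ i * eval (ζ i) p := by
    intro p
    simp [hΛ, MvPolynomial.aeval_eq_eval]
  have key : ∀ p, (∀ q, Λ (p * q) = 0) ↔ ∀ i, eval (ζ i) p = 0 := by
    intro p
    constructor
    · intro h i
      obtain ⟨q, hq⟩ := exists_interp ζ hζ i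
      have := h q
      rw [hL] at this
      simpa [hq, hγ i] using this
    · intro h q
      simp [hL, h]
  have h1 : hankelIdeal Λ = vanishIdeal (Set.range ζ) := by
    ext p
    change (∀ q, Λ (p * q) = 0) ↔ ∀ x ∈ Set.range ζ, eval x p = 0
    rw [key p, Set.forall_mem_range]
  let E : MvPolynomial (Fin n) K →ₗ[K] (Fin r → K) :=
    LinearMap.pi fun i => (MvPolynomial.aeval (ζ i) :
        MvPolynomial (Fin n) K →ₐ[K] K).toLinearMap
  have hE : ∀ p i, E p i = eval (ζ i) p := by
    intro p i
    simp [E, MvPolynomial.aeval_eq_eval]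
  have hsurj : LinearMap.range E = ⊤ := by
    rw [LinearMap.range_eq_top]
    intro v
    choose q hq using exists_interp ζ hζ
    refine ⟨∑ i, C (v i) * q i, ?_⟩
    ext j
    rw [hE]
    simp [hq]
  have hker : LinearMap.ker (hankel Λ) = LinearMap.ker E := by
    ext p
    rw [LinearMap.mem_ker, LinearMap.mem_ker, funext_iff, LinearMap.ext_iff]
    simp only [hE]
    exact key p
  let e : LinearMap.range (hankel Λ) ≃ₗ[K] (Fin r → K) :=
    (hankel Λ).quotKerEquivRange.symm ≪≫ₗ Submodule.quotEquivOfEq _ _ hker ≪≫ₗ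
      E.quotKerEquivOfSurjective (LinearMap.range_eq_top.mp hsurj)
  refine ⟨h1, ?_, Module.Finite.equiv e.symm, by simpa using e.finrank_eq⟩
  rw [h1]
  rintro p ⟨m, hm⟩ x hx
  have := hm x hx
  rw [map_pow] at this
  exact eq_zero_of_pow_eq_zero this
end

section
/- Let K be an algebraically closed field of characteristic 0 and let Λ be a K-linear functional on R = K[x₁,…,xₙ] such that the Hankel operator H_Λ has finite rank r and I_Λ is a radical ideal. Then there exist r distinct points ζ₁,…,ζ_r ∈ Kⁿ and nonzero scalars γ₁,…,γ_r ∈ K such that Λ = Σ_{i=1}^r γ_i·1_{ζ_i}. -/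
open MvPolynomial

theorem finite_of_linearIndependent_of_ker {K M W ι : Type*} [Field K] [AddCommGroup M]
    [Module K M] [AddCommGroup W] [Module K W] (H : M →ₗ[K] W)
    (hfin : Module.Finite K (LinearMap.range H)) (f : ι → (M →ₗ[K] K))
    (hli : LinearIndependent K f) (hf : ∀ x, ∀ p ∈ LinearMap.ker H, f x p = 0) :
    Finite ι ∧ Nat.card ι ≤ Module.finrank K (LinearMap.range H) := by
  let D := H.rangeRestrict.dualMap
  have hmem : ∀ x, f x ∈ LinearMap.range D := by
    intro x
    change f x ∈ LinearMap.range H.rangeRestrict.dualMap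
    rw [LinearMap.range_dualMap_eq_dualAnnihilator_ker, Submodule.mem_dualAnnihilator]
    intro p hp
    rw [LinearMap.ker_rangeRestrict] at hp
    exact hf x p hp
  let g : ι → LinearMap.range D := fun x => ⟨f x, hmem x⟩
  have hg : LinearIndependent K g :=
    LinearIndependent.of_comp (LinearMap.range D).subtype hli
  have hVfin : Finite ι := hg.finite_of_isNoetherian
  have : Fintype ι := Fintype.ofFinite ι
  refine ⟨hVfin, ?_⟩
  rw [Nat.card_eq_fintype_card]
  refine hg.fintype_card_le_finrank.trans ((LinearMap.finrank_range_le D).trans ?_)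
  exact (Subspace.dual_finrank_eq).le

/-- Over an algebraically closed field of characteristic 0, if H_Λ has
finite rank r and I_Λ is radical, then Λ = Σ γᵢ·1_{ζᵢ} for r distinct points ζᵢ and
nonzero scalars γᵢ. -/
theorem hankel_rank_radical_implies_decomposition
    {K : Type*} [Field K] [IsAlgClosed K] [CharZero K] {n r : ℕ}
    (Λ : MvPolynomial (Fin n) K →ₗ[K] K)
    (hfin : Module.Finite K (LinearMap.range (hankel Λ)))
    (hrank : Module.finrank K (LinearMap.range (hankel Λ)) = r)
    (hrad : (hankelIdeal Λ).IsRadical) :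
    ∃ (ζ : Fin r → (Fin n → K)) (γ : Fin r → K),
      Function.Injective ζ ∧ (∀ i, γ i ≠ 0) ∧
      Λ = ∑ i, γ i • (MvPolynomial.aeval (ζ i) :
          MvPolynomial (Fin n) K →ₐ[K] K).toLinearMap := by
  classical
  set I := hankelIdeal Λ with hI
  let V := zeroLocus K I
  have hIV : ∀ p, p ∈ I ↔ ∀ x : V, aeval (x : Fin n → K) p = 0 := by
    intro p
    have h := vanishingIdeal_zeroLocus_eq_radical (K := K) I
    rw [hrad.radical] at h
    rw [← h, mem_vanishingIdeal_iff]
    exact ⟨fun h x => h x x.2, fun h x hx => h ⟨x, hx⟩⟩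
  have hker : ∀ p, p ∈ LinearMap.ker (hankel Λ) ↔ p ∈ I := by
    intro p
    rw [LinearMap.mem_ker, LinearMap.ext_iff]
    exact Iff.rfl
  let f : V → (MvPolynomial (Fin n) K →ₗ[K] K) := fun x =>
    (aeval (x : Fin n → K) : MvPolynomial (Fin n) K →ₐ[K] K).toLinearMap
  have hli : LinearIndependent K f := by
    refine (linearIndependent_toLinearMap K (MvPolynomial (Fin n) K) K).comp
      (fun x : V => (aeval (x : Fin n → K) : MvPolynomial (Fin n) K →ₐ[K] K)) ?_
    intro x y h
    apply Subtype.ext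
    funext i
    simpa using DFunLike.congr_fun h (X i)
  obtain ⟨hVfin, hle'⟩ := finite_of_linearIndependent_of_ker (hankel Λ) hfin f hli
    (fun x p hp => (hIV p).1 ((hker p).1 hp) x)
  have : Fintype V := Fintype.ofFinite V
  have hle : Fintype.card V ≤ r := by
    rw [← hrank, ← Nat.card_eq_fintype_card]
    exact hle'
  let E : MvPolynomial (Fin n) K →ₗ[K] (V → K) := LinearMap.pi f
  have hE : LinearMap.ker E = LinearMap.ker (hankel Λ) := by
    ext p
    rw [hker, hIV, LinearMap.mem_ker, _root_.funext_iff]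
    exact Iff.rfl
  have hEr : Module.finrank K (LinearMap.range E) = r := by
    rw [← hrank, ← E.quotKerEquivRange.finrank_eq, hE,
      (hankel Λ).quotKerEquivRange.finrank_eq]
  have hcard : Fintype.card V = r := by
    refine le_antisymm hle ?_
    rw [← hEr, ← Module.finrank_fintype_fun_eq_card K]
    exact Submodule.finrank_le _
  have hsurj : Function.Surjective E := by
    rw [← LinearMap.range_eq_top]
    apply Submodule.eq_top_of_finrank_eq
    rw [hEr, Module.finrank_fintype_fun_eq_card, hcard]
  have hspan : Λ ∈ Submodule.span K (Set.range f) := by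
    refine mem_span_of_iInf_ker_le_ker fun p hp => ?_
    have hp' : p ∈ I := (hIV p).2 fun x => (Submodule.mem_iInf _).1 hp x
    simpa using hp' 1
  obtain ⟨c, hc⟩ := (Submodule.mem_span_range_iff_exists_fun K).1 hspan
  have hc0 : ∀ x, c x ≠ 0 := by
    intro x hx
    obtain ⟨p, hp⟩ := hsurj (Pi.single x 1)
    have hpe : ∀ y : V, aeval (y : Fin n → K) p = (Pi.single x (1 : K) : V → K) y :=
      fun y => congrFun hp y
    have hpI : p ∈ I := by
      intro q
      rw [← hc, LinearMap.sum_apply]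
      refine Finset.sum_eq_zero fun y _ => ?_
      by_cases h : y = x
      · subst h; simp [hx]
      · have h0 : aeval (y : Fin n → K) p = 0 := by rw [hpe]; simp [h]
        change c y • aeval (y : Fin n → K) (p * q) = 0
        rw [map_mul, h0, zero_mul, smul_zero]
    have := (hIV p).1 hpI x
    rw [hpe] at this
    simp at this
  let e : Fin r ≃ V := (Fintype.equivFinOfCardEq hcard).symm
  refine ⟨fun i => (e i : Fin n → K), fun i => c (e i),
    Subtype.val_injective.comp e.injective, fun i => hc0 _, ?_⟩
  rw [← hc]
  exact (Equiv.sum_comp e (fun x => c x • f x)).symm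
end

section
/- Let B = {m₁,…,m_r} and B' = {m'₁,…,m'_r} be two sets of r monomials in R = K[x₁,…,xₙ], each connected to 1, and let Λ be a K-linear functional defined on the linear span of all products b'·b with b' ∈ B' and b ∈ B⁺. Set H = (Λ(m'_i·m_j))_{1≤i,j≤r} and, for each variable x_l, H_l = (Λ(x_l·m'_i·m_j))_{1≤i,j≤r}. Then there exists a K-linear functional Λ̃ on all of R that agrees with Λ on span(B'·B⁺), such that the Hankel operator H_Λ̃ has rank r and the classes of B and of B' are each bases of R/I_Λ̃, if and only if H is invertible and the matrices M_l := H⁻¹·H_l pairwise commute. Moreover, when it exists, such a Λ̃ is unique. -/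
open MvPolynomial

/-- A family of monomials (given by exponent vectors) is connected to 1 if every
member is either 1 or of the form xₗ·m' for some variable xₗ and member m'. -/
def ConnectedToOne {n r : ℕ} (α : Fin r → (Fin n →₀ ℕ)) : Prop :=
  ∀ i, α i = 0 ∨ ∃ (l : Fin n) (i' : Fin r), α i = Finsupp.single l 1 + α i'

open MvPolynomial Matrix

section helpers
variable {K : Type*} [Field K] {n r : ℕ}

theorem aux_hom (M : Fin n → Matrix (Fin r) (Fin r) K)
    (h : ∀ l l', M l * M l' = M l' * M l) :
    ∃ φ : MvPolynomial (Fin n) K →ₐ[K] Matrix (Fin r) (Fin r) K, ∀ l, φ (X l) = M l := by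
  letI : CommRing (Algebra.adjoin K (Set.range M)) :=
    Algebra.adjoinCommRingOfComm K (by
      rintro _ ⟨a, rfl⟩ _ ⟨b, rfl⟩
      exact h a b)
  refine ⟨(Algebra.adjoin K (Set.range M)).val.comp
    (aeval fun l => ⟨M l, Algebra.subset_adjoin ⟨l, rfl⟩⟩), fun l => ?_⟩
  simp

theorem mem_hI (Λ : MvPolynomial (Fin n) K →ₗ[K] K) (p : MvPolynomial (Fin n) K) :
    p ∈ hankelIdeal Λ ↔ ∀ q, Λ (p * q) = 0 := Iff.rfl

theorem rank_equiv (Λ : MvPolynomial (Fin n) K →ₗ[K] K) :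
    Nonempty ((MvPolynomial (Fin n) K ⧸ hankelIdeal Λ) ≃ₗ[K] LinearMap.range (hankel Λ)) := by
  have hk : (hankelIdeal Λ).restrictScalars K = LinearMap.ker (hankel Λ) := by
    ext p
    rw [Submodule.restrictScalars_mem, mem_hI, LinearMap.mem_ker, LinearMap.ext_iff]
    rfl
  exact ⟨(Submodule.Quotient.restrictScalarsEquiv K (hankelIdeal Λ)).symm ≪≫ₗ
    (Submodule.quotEquivOfEq _ _ hk) ≪≫ₗ (hankel Λ).quotKerEquivRange⟩

theorem mk_sum (I : Ideal (MvPolynomial (Fin n) K)) (g : Fin r → K)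
    (m : Fin r → MvPolynomial (Fin n) K) :
    ∑ i, g i • Ideal.Quotient.mk I (m i) = Ideal.Quotient.mk I (∑ i, g i • m i) := by
  rw [map_sum]; rfl

/-- Connected families contain 1 and admit induction. -/
theorem conn_ind {α : Fin r → (Fin n →₀ ℕ)} (hc : ConnectedToOne α) {P : Fin r → Prop}
    (h0 : ∀ i, α i = 0 → P i)
    (hs : ∀ i l i', α i = Finsupp.single l 1 + α i' → P i' → P i) : ∀ i, P i := by
  have : ∀ d, ∀ i, (α i).degree = d → P i := by
    intro d
    induction d with
    | zero => intro i hi; exact h0 i ((Finsupp.degree_eq_zero_iff _).1 hi)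
    | succ d ih =>
      intro i hi
      rcases hc i with h | ⟨l, i', h⟩
      · exact h0 i h
      · refine hs i l i' h (ih i' ?_)
        rw [h, map_add, Finsupp.degree_single] at hi
        omega
  exact fun i => this _ i rfl

theorem conn_one {α : Fin r → (Fin n →₀ ℕ)} (hc : ConnectedToOne α) (j : Fin r) :
    ∃ i, α i = 0 :=
  conn_ind (P := fun _ => ∃ i, α i = 0) hc (fun i h => ⟨i, h⟩) (fun _ _ _ _ h => h) j

theorem mon_succ {a b : Fin n →₀ ℕ} {l : Fin n} (h : a = Finsupp.single l 1 + b) :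
    monomial a (1 : K) = X l * monomial b 1 := by
  rw [h, X, monomial_mul, one_mul]

theorem exists_u {α : Fin r → (Fin n →₀ ℕ)} (hα : Function.Injective α) (hc : ConnectedToOne α)
    (φ : MvPolynomial (Fin n) K →ₐ[K] Matrix (Fin r) (Fin r) K)
    (h : ∀ i l i', α i = Finsupp.single l 1 + α i' →
      φ (X l) *ᵥ (Pi.single i' 1) = Pi.single i 1) :
    ∃ u : Fin r → K, ∀ j, φ (monomial (α j) 1) *ᵥ u = Pi.single j 1 := by
  by_cases hr : ∃ i, α i = 0
  · obtain ⟨i0, hi0⟩ := hr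
    refine ⟨Pi.single i0 1, conn_ind hc ?_ ?_⟩
    · intro i hi
      obtain rfl : i = i0 := hα (hi.trans hi0.symm)
      rw [hi, ← one_def, map_one, one_mulVec]
    · intro i l i' hi ih
      rw [mon_succ hi, map_mul, ← mulVec_mulVec, ih, h i l i' hi]
  · exact ⟨0, fun j => (hr (conn_one hc j)).elim⟩

theorem exists_w {α : Fin r → (Fin n →₀ ℕ)} (hα : Function.Injective α) (hc : ConnectedToOne α)
    (φ : MvPolynomial (Fin n) K →ₐ[K] Matrix (Fin r) (Fin r) K)
    (H : Matrix (Fin r) (Fin r) K)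
    (h : ∀ i l i', α i = Finsupp.single l 1 + α i' → H i' ᵥ* φ (X l) = H i) :
    ∃ w : Fin r → K, ∀ j, w ᵥ* φ (monomial (α j) 1) = H j := by
  by_cases hr : ∃ i, α i = 0
  · obtain ⟨i0, hi0⟩ := hr
    refine ⟨H i0, conn_ind hc ?_ ?_⟩
    · intro i hi
      obtain rfl : i = i0 := hα (hi.trans hi0.symm)
      rw [hi, ← one_def, map_one, vecMul_one]
    · intro i l i' hi ih
      rw [mon_succ hi, mul_comm, map_mul, ← vecMul_vecMul, ih, h i l i' hi]
  · exact ⟨0, fun j => (hr (conn_one hc j)).elim⟩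

/-- Functional given by coordinates. -/
theorem coord (α α' : Fin r → (Fin n →₀ ℕ))
    (Λ : MvPolynomial (Fin n) K →ₗ[K] K)
    (hB : LinearIndependent K
          (fun i => Ideal.Quotient.mk (hankelIdeal Λ) (monomial (α i) (1 : K))) ∧
        Submodule.span K
          (Set.range fun i =>
            Ideal.Quotient.mk (hankelIdeal Λ) (monomial (α i) (1 : K))) = ⊤)
    (hB' : LinearIndependent K
          (fun i => Ideal.Quotient.mk (hankelIdeal Λ) (monomial (α' i) (1 : K))) ∧
        Submodule.span K
          (Set.range fun i =>
            Ideal.Quotient.mk (hankelIdeal Λ) (monomial (α' i) (1 : K))) = ⊤)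
    (H : Matrix (Fin r) (Fin r) K) (N : Fin n → Matrix (Fin r) (Fin r) K)
    (hH : ∀ i j, Λ (monomial (α' i) (1 : K) * monomial (α j) 1) = H i j)
    (hN : ∀ l i j, Λ (monomial (α' i) (1 : K) * (X l * monomial (α j) 1)) = N l i j) :
    IsUnit H ∧ ∃ c : MvPolynomial (Fin n) K →ₗ[K] (Fin r → K),
      (∀ j, c (monomial (α j) 1) = Pi.single j 1) ∧
      (∀ l p, c (X l * p) = (H⁻¹ * N l) *ᵥ c p) ∧
      (∀ p q, Λ (q * p) = ∑ j, c p j * Λ (q * monomial (α j) 1)) ∧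
      (∀ p, (∀ i, Λ (monomial (α' i) (1 : K) * p) = 0) → c p = 0) := by
  classical
  let b := Module.Basis.mk hB.1 hB.2.ge
  let c : MvPolynomial (Fin n) K →ₗ[K] (Fin r → K) :=
    b.equivFun.toLinearMap ∘ₗ (Ideal.Quotient.mkₐ K (hankelIdeal Λ)).toLinearMap
  have hc0 : ∀ p, c p = b.equivFun (Ideal.Quotient.mk (hankelIdeal Λ) p) := fun p => rfl
  have hc1 : ∀ j, c (monomial (α j) 1) = Pi.single j 1 := by
    intro j
    rw [hc0]
    have : Ideal.Quotient.mk (hankelIdeal Λ) (monomial (α j) (1 : K)) = b j := by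
      simp [b]
    rw [this]
    ext i
    rw [Module.Basis.equivFun_self]
    simp [Pi.single_apply, eq_comm]
  have hc2 : ∀ p, p - ∑ j, c p j • monomial (α j) (1 : K) ∈ hankelIdeal Λ := by
    intro p
    rw [← Ideal.Quotient.eq, ← mk_sum]
    conv_lhs => rw [← b.sum_equivFun (Ideal.Quotient.mk (hankelIdeal Λ) p)]
    simp [b, hc0]
  have hc3 : ∀ p q, Λ (q * p) = ∑ j, c p j * Λ (q * monomial (α j) 1) := by
    intro p q
    have := (mem_hI _ _).1 (hc2 p) q
    rw [mul_comm, mul_sub, map_sub, sub_eq_zero] at this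
    rw [this, Finset.mul_sum, map_sum]
    simp
  have hc4 : ∀ p, (∀ i, Λ (monomial (α' i) (1 : K) * p) = 0) → c p = 0 := by
    intro p hp
    have : p ∈ hankelIdeal Λ := by
      rw [mem_hI]
      intro q
      have hq : Ideal.Quotient.mk (hankelIdeal Λ) q ∈ Submodule.span K
          (Set.range fun i =>
            Ideal.Quotient.mk (hankelIdeal Λ) (monomial (α' i) (1 : K))) := by
        rw [hB'.2]; trivial
      obtain ⟨g, hg⟩ := (Submodule.mem_span_range_iff_exists_fun K).1 hq
      rw [mk_sum, eq_comm, Ideal.Quotient.eq, mem_hI] at hg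
      have := hg p
      rw [sub_mul, map_sub, sub_eq_zero] at this
      rw [mul_comm, this, Finset.sum_mul, map_sum]
      simp [hp]
    rw [hc0, Ideal.Quotient.eq_zero_iff_mem.2 this, map_zero]
  have hHc : ∀ p i, (H *ᵥ c p) i = Λ (monomial (α' i) (1 : K) * p) := by
    intro p i
    rw [hc3]
    simp only [mulVec, dotProduct, hH]
    exact Finset.sum_congr rfl fun j _ => mul_comm _ _
  have hcsum : ∀ v : Fin r → K, c (∑ j, v j • monomial (α j) (1 : K)) = v := by
    intro v
    rw [map_sum]
    simp only [map_smul, hc1]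
    ext i
    simp [Pi.single_apply]
  have hU : IsUnit H := by
    rw [← Matrix.mulVec_injective_iff_isUnit]
    have : Function.Injective (Matrix.mulVecLin H) := by
      rw [injective_iff_map_eq_zero]
      intro v hv
      rw [← hcsum v]
      apply hc4
      intro i
      rw [← hHc, hcsum]
      exact congrFun hv i
    exact this
  refine ⟨hU, c, hc1, ?_, hc3, hc4⟩
  intro l p
  have hinj := Matrix.mulVec_injective_iff_isUnit.2 hU
  apply hinj
  rw [mulVec_mulVec, ← mul_assoc, Matrix.mul_nonsing_inv _ ((Matrix.isUnit_iff_isUnit_det _).1 hU),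
    one_mul]
  ext i
  rw [hHc, ← mul_assoc, hc3]
  simp only [mulVec, dotProduct, mul_assoc, hN]
  exact Finset.sum_congr rfl fun j _ => mul_comm _ _

end helpers

/-- flat-extension criterion via commutation: Λ (given by its values
on span(B'·B⁺)) admits a unique extension Λ̃ to R with rank H_Λ̃ = r and the classes
of B, B' bases of R/I_Λ̃, iff H = (Λ(m'ᵢ·mⱼ)) is invertible and the formal
multiplication matrices M_l = H⁻¹·H_l pairwise commute. -/
theorem flat_extension_commutation_criterion {K : Type*} [Field K] {n r : ℕ}
    (α α' : Fin r → (Fin n →₀ ℕ))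
    (hα : Function.Injective α) (hα' : Function.Injective α')
    (hcα : ConnectedToOne α) (hcα' : ConnectedToOne α')
    (Λ : MvPolynomial (Fin n) K →ₗ[K] K) :
    (∃! Λt : MvPolynomial (Fin n) K →ₗ[K] K,
      ((∀ i j, Λt (monomial (α' i) (1 : K) * monomial (α j) 1) =
          Λ (monomial (α' i) (1 : K) * monomial (α j) 1)) ∧
       (∀ (l : Fin n) i j,
          Λt (monomial (α' i) (1 : K) * (X l * monomial (α j) 1)) =
          Λ (monomial (α' i) (1 : K) * (X l * monomial (α j) 1)))) ∧
      Module.Finite K (LinearMap.range (hankel Λt)) ∧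
      Module.finrank K (LinearMap.range (hankel Λt)) = r ∧
      (LinearIndependent K
          (fun i => Ideal.Quotient.mk (hankelIdeal Λt) (monomial (α i) (1 : K))) ∧
        Submodule.span K
          (Set.range fun i =>
            Ideal.Quotient.mk (hankelIdeal Λt) (monomial (α i) (1 : K))) = ⊤) ∧
      (LinearIndependent K
          (fun i => Ideal.Quotient.mk (hankelIdeal Λt) (monomial (α' i) (1 : K))) ∧
        Submodule.span K
          (Set.range fun i =>
            Ideal.Quotient.mk (hankelIdeal Λt) (monomial (α' i) (1 : K))) = ⊤))
    ↔
    (IsUnit ((Matrix.of fun i j =>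
        Λ (monomial (α' i) (1 : K) * monomial (α j) 1)) : Matrix (Fin r) (Fin r) K) ∧
     ∀ l l' : Fin n,
       (((Matrix.of fun i j => Λ (monomial (α' i) (1 : K) * monomial (α j) 1)) :
          Matrix (Fin r) (Fin r) K)⁻¹ *
        (Matrix.of fun i j =>
          Λ (X l * (monomial (α' i) (1 : K) * monomial (α j) 1)))) *
       (((Matrix.of fun i j => Λ (monomial (α' i) (1 : K) * monomial (α j) 1)) :
          Matrix (Fin r) (Fin r) K)⁻¹ *
        (Matrix.of fun i j =>
          Λ (X l' * (monomial (α' i) (1 : K) * monomial (α j) 1)))) =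
       (((Matrix.of fun i j => Λ (monomial (α' i) (1 : K) * monomial (α j) 1)) :
          Matrix (Fin r) (Fin r) K)⁻¹ *
        (Matrix.of fun i j =>
          Λ (X l' * (monomial (α' i) (1 : K) * monomial (α j) 1)))) *
       (((Matrix.of fun i j => Λ (monomial (α' i) (1 : K) * monomial (α j) 1)) :
          Matrix (Fin r) (Fin r) K)⁻¹ *
        (Matrix.of fun i j =>
          Λ (X l * (monomial (α' i) (1 : K) * monomial (α j) 1))))) := by
  classical
  set H : Matrix (Fin r) (Fin r) K :=
    Matrix.of fun i j => Λ (monomial (α' i) (1 : K) * monomial (α j) 1) with hHdef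
  set N : Fin n → Matrix (Fin r) (Fin r) K := fun l =>
    Matrix.of fun i j => Λ (X l * (monomial (α' i) (1 : K) * monomial (α j) 1)) with hNdef
  have hN' : ∀ l i j, Λ (monomial (α' i) (1 : K) * (X l * monomial (α j) 1)) = N l i j := by
    intro l i j
    simp only [hNdef, of_apply]
    rw [mul_left_comm]
  change _ ↔ (IsUnit H ∧ ∀ l l', (H⁻¹ * N l) * (H⁻¹ * N l') = (H⁻¹ * N l') * (H⁻¹ * N l))
  constructor
  · rintro ⟨L, ⟨⟨h1, h2⟩, -, -, hB, hB'⟩, -⟩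
    obtain ⟨hU, c, hc1, hc2, -, -⟩ := coord α α' L hB hB' H N (fun i j => h1 i j)
      (fun l i j => (h2 l i j).trans (hN' l i j))
    refine ⟨hU, fun l l' => ?_⟩
    apply Matrix.ext_of_mulVec_single
    intro j
    rw [← hc1 j, ← mulVec_mulVec (c _) (H⁻¹ * N l), ← mulVec_mulVec (c _) (H⁻¹ * N l'),
      ← hc2, ← hc2, ← hc2, ← hc2, mul_left_comm]
  · rintro ⟨hU, hcomm⟩
    have hdet := (Matrix.isUnit_iff_isUnit_det _).1 hU
    apply existsUnique_of_exists_of_unique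
    · obtain ⟨φ, hφ⟩ := aux_hom (fun l => H⁻¹ * N l) hcomm
      have hHφ : ∀ l, H * φ (X l) = N l := by
        intro l
        rw [hφ, ← mul_assoc, Matrix.mul_nonsing_inv _ hdet, one_mul]
      have hinj := Matrix.mulVec_injective_iff_isUnit.2 hU
      have hinj' := Matrix.vecMul_injective_iff_isUnit.2 hU
      obtain ⟨u, hu⟩ := exists_u hα hcα φ (by
        intro i l i' h
        apply hinj
        rw [mulVec_mulVec, hHφ]
        ext k
        rw [mulVec_single_one, mulVec_single_one]
        simp only [col_apply]
        rw [← hN', ← mon_succ h]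
        rfl)
      obtain ⟨w, hw⟩ := exists_w hα' hcα' φ H (by
        intro i l i' h
        have : H i' = Pi.single i' 1 ᵥ* H := by simp [row]
        rw [this, vecMul_vecMul, hHφ]
        ext k
        rw [single_one_vecMul]
        change N l i' k = Λ _
        rw [mon_succ h, mul_assoc]
        rfl)
      let L : MvPolynomial (Fin n) K →ₗ[K] K :=
        { toFun := fun p => w ⬝ᵥ (φ p *ᵥ u)
          map_add' := by intro p q; rw [map_add, add_mulVec, dotProduct_add]
          map_smul' := by intro a p; rw [map_smul, smul_mulVec, dotProduct_smul]; rfl }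
      have hL : ∀ p, L p = w ⬝ᵥ (φ p *ᵥ u) := fun p => rfl
      have hL3 : ∀ i p j, L (monomial (α' i) (1 : K) * (p * monomial (α j) 1)) =
          (H * φ p) i j := by
        intro i p j
        rw [hL, map_mul, map_mul, ← mulVec_mulVec, ← mulVec_mulVec, hu, dotProduct_mulVec, hw,
          mulVec_single_one]
        rfl
      have hI : ∀ p, p ∈ hankelIdeal L → φ p = 0 := by
        intro p hp
        have h0 : H * φ p = 0 := by
          ext i j
          rw [← hL3, mul_left_comm]
          exact hp _
        rw [← one_mul (φ p), ← Matrix.nonsing_inv_mul _ hdet, mul_assoc, h0, mul_zero]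
      have hI' : ∀ p, φ p *ᵥ u = 0 → p ∈ hankelIdeal L := by
        intro p hp q
        rw [mul_comm, hL, map_mul, ← mulVec_mulVec, hp, mulVec_zero, dotProduct_zero]
      have hsumu : ∀ g : Fin r → K, φ (∑ j, g j • monomial (α j) (1 : K)) *ᵥ u = g := by
        intro g
        rw [map_sum, sum_mulVec]
        simp only [map_smul, smul_mulVec, hu]
        ext i
        simp [Pi.single_apply]
      have hsumw : ∀ g : Fin r → K, w ᵥ* φ (∑ j, g j • monomial (α' j) (1 : K)) = g ᵥ* H := by
        intro g
        rw [map_sum, vecMul_sum]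
        simp only [map_smul, vecMul_smul, hw]
        ext i
        simp [vecMul, dotProduct]
      have hB : LinearIndependent K
          (fun i => Ideal.Quotient.mk (hankelIdeal L) (monomial (α i) (1 : K))) := by
        rw [Fintype.linearIndependent_iff]
        intro g hg
        rw [mk_sum, Ideal.Quotient.eq_zero_iff_mem] at hg
        have := hsumu g
        rw [hI _ hg, zero_mulVec] at this
        intro i; rw [← this]; rfl
      have hBs : Submodule.span K (Set.range fun i =>
            Ideal.Quotient.mk (hankelIdeal L) (monomial (α i) (1 : K))) = ⊤ := by
        rw [eq_top_iff]
        rintro x -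
        obtain ⟨p, rfl⟩ := Ideal.Quotient.mk_surjective x
        rw [Submodule.mem_span_range_iff_exists_fun]
        refine ⟨φ p *ᵥ u, ?_⟩
        rw [mk_sum, Ideal.Quotient.eq]
        apply hI'
        rw [map_sub, sub_mulVec, hsumu, sub_self]
      have hB' : LinearIndependent K
          (fun i => Ideal.Quotient.mk (hankelIdeal L) (monomial (α' i) (1 : K))) := by
        rw [Fintype.linearIndependent_iff]
        intro g hg
        rw [mk_sum, Ideal.Quotient.eq_zero_iff_mem] at hg
        have := hsumw g
        rw [hI _ hg, vecMul_zero] at this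
        have h0 : g = 0 := hinj' (by simpa using this.symm)
        intro i; rw [h0]; rfl
      let b := Module.Basis.mk hB hBs.ge
      have hfr : Module.finrank K (MvPolynomial (Fin n) K ⧸ hankelIdeal L) = r := by
        rw [Module.finrank_eq_card_basis b, Fintype.card_fin]
      haveI : Module.Finite K (MvPolynomial (Fin n) K ⧸ hankelIdeal L) := Module.Finite.of_basis b
      obtain ⟨e⟩ := rank_equiv L
      refine ⟨L, ⟨?_, ?_⟩, Module.Finite.equiv e, e.finrank_eq.symm.trans hfr, ⟨hB, hBs⟩, hB', ?_⟩
      · intro i j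
        have := hL3 i 1 j
        rw [one_mul, map_one φ, mul_one H] at this
        exact this
      · intro l i j
        rw [hL3, hHφ, hN']
      · exact hB'.span_eq_top_of_card_eq_finrank' (by rw [hfr, Fintype.card_fin])
    · rintro L₁ L₂ ⟨⟨h1, h2⟩, -, -, hB, hB'⟩ ⟨⟨k1, k2⟩, -, -, kB, kB'⟩
      obtain ⟨-, c, hc1, hc2, hc3, -⟩ := coord α α' L₁ hB hB' H N (fun i j => h1 i j)
        (fun l i j => (h2 l i j).trans (hN' l i j))
      obtain ⟨-, d, hd1, hd2, hd3, -⟩ := coord α α' L₂ kB kB' H N (fun i j => k1 i j)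
        (fun l i j => (k2 l i j).trans (hN' l i j))
      have hone : c 1 = d 1 := by
        ext j
        obtain ⟨j0, hj0⟩ := conn_one hcα j
        have e1 := hc1 j0
        have e2 := hd1 j0
        rw [hj0, ← one_def] at e1 e2
        rw [e1, e2]
      have hcd : ∀ p, c p = d p := by
        intro p
        induction p using MvPolynomial.induction_on with
        | C a =>
          rw [← mul_one (C a), ← smul_eq_C_mul, map_smul, map_smul, hone]
        | add p q hp hq => rw [map_add, map_add, hp, hq]
        | mul_X p l hp => rw [mul_comm, hc2, hd2, hp]
      refine LinearMap.ext fun p => ?_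
      rw [← one_mul p, hc3, hd3, hcd]
      refine Finset.sum_congr rfl fun j _ => ?_
      obtain ⟨i0, hi0⟩ := conn_one hcα' j
      have e1 := h1 i0 j
      have e2 := k1 i0 j
      rw [hi0, ← one_def] at e1 e2
      rw [e1, e2]
end

section
/- Let B = {m₁,…,m_r} and B' = {m'₁,…,m'_r} be two sets of r monomials in R = K[x₁,…,xₙ], each connected to 1. If Λ̃₁ and Λ̃₂ are two K-linear functionals on R that agree on the linear span of all products b'·b with b' ∈ B', b ∈ B⁺, and if both Hankel operators H_Λ̃₁ and H_Λ̃₂ have rank r with the matrices (Λ̃₁(m'_i·m_j)) and (Λ̃₂(m'_i·m_j)) invertible, then Λ̃₁ = Λ̃₂. -/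
open MvPolynomial

theorem hankel_app {K : Type*} [Field K] {n : ℕ}
    (Λ : MvPolynomial (Fin n) K →ₗ[K] K) (p q : MvPolynomial (Fin n) K) :
    hankel Λ p q = Λ (p * q) := rfl

theorem conn_zero {n r : ℕ} (α : Fin r → (Fin n →₀ ℕ)) (h : ConnectedToOne α) (i : Fin r) :
    ∃ j, α j = 0 := by
  haveI : Nonempty (Fin r) := ⟨i⟩
  obtain ⟨j, hj⟩ := Finite.exists_min (fun i => (α i).degree)
  refine ⟨j, ?_⟩
  rcases h j with h0 | ⟨l, k, hk⟩
  · exact h0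
  · have := hj k
    simp only [hk, map_add, Finsupp.degree_single] at this
    omega

theorem coeff_zero {K : Type*} [Field K] {n r : ℕ}
    (α α' : Fin r → (Fin n →₀ ℕ)) (Λ : MvPolynomial (Fin n) K →ₗ[K] K)
    (hH : IsUnit ((Matrix.of fun i j =>
        Λ (monomial (α' i) (1 : K) * monomial (α j) 1)) : Matrix (Fin r) (Fin r) K))
    (g : Fin r → K)
    (hg : ∀ i, Λ (monomial (α' i) (1 : K) * ∑ j, g j • monomial (α j) (1 : K)) = 0) : g = 0 := by
  have hinj := Matrix.mulVec_injective_of_isUnit hH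
  apply hinj
  rw [Matrix.mulVec_zero]
  funext i
  have := hg i
  rw [Finset.mul_sum, map_sum] at this
  simp only [mul_smul_comm, map_smul, smul_eq_mul] at this
  simp only [Matrix.mulVec, dotProduct, Matrix.of_apply, Pi.zero_apply]
  rw [← this]
  exact Finset.sum_congr rfl fun j _ => mul_comm _ _

theorem rep_aux {K V W : Type*} [Field K] [AddCommGroup V] [Module K V] [AddCommGroup W]
    [Module K W] {r : ℕ} (f : V →ₗ[K] W)
    (hfin : Module.Finite K (LinearMap.range f))
    (hrank : Module.finrank K (LinearMap.range f) = r) (m : Fin r → V)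
    (hm : ∀ g : Fin r → K, f (∑ j, g j • m j) = 0 → g = 0) (p : V) :
    ∃ g : Fin r → K, f p = f (∑ j, g j • m j) := by
  let v : Fin r → LinearMap.range f := fun j => ⟨f (m j), LinearMap.mem_range_self _ _⟩
  have hv : LinearIndependent K v := by
    rw [Fintype.linearIndependent_iff]
    intro g hg
    have h0 : f (∑ j, g j • m j) = 0 := by
      have := congrArg (Submodule.subtype _) hg
      simpa [v, map_sum] using this
    intro i
    rw [hm g h0]; rfl
  have hs := hv.span_eq_top_of_card_eq_finrank' (by simp [hrank])
  have hm : (⟨f p, LinearMap.mem_range_self _ _⟩ : LinearMap.range f) ∈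
      Submodule.span K (Set.range v) := by rw [hs]; trivial
  obtain ⟨g, hg⟩ := (Submodule.mem_span_range_iff_exists_fun K).1 hm
  refine ⟨g, ?_⟩
  have := congrArg (Submodule.subtype _) hg
  simp only [map_sum, map_smul, Submodule.subtype_apply, v] at this
  rw [map_sum, ← this]
  simp only [map_smul]

theorem exists_rep {K : Type*} [Field K] {n r : ℕ}
    (α α' : Fin r → (Fin n →₀ ℕ)) (Λ : MvPolynomial (Fin n) K →ₗ[K] K)
    (hfin : Module.Finite K (LinearMap.range (hankel Λ)))
    (hrank : Module.finrank K (LinearMap.range (hankel Λ)) = r)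
    (hH : IsUnit ((Matrix.of fun i j =>
        Λ (monomial (α' i) (1 : K) * monomial (α j) 1)) : Matrix (Fin r) (Fin r) K))
    (p : MvPolynomial (Fin n) K) :
    ∃ g : Fin r → K, hankel Λ p = hankel Λ (∑ j, g j • monomial (α j) (1 : K)) := by
  refine rep_aux (hankel Λ) hfin hrank _ (fun g h0 => ?_) p
  exact coeff_zero α α' Λ hH g (fun i => by
      rw [mul_comm, ← hankel_app, h0]; rfl)

theorem ker_of_test {K : Type*} [Field K] {n r : ℕ}
    (α α' : Fin r → (Fin n →₀ ℕ)) (Λ : MvPolynomial (Fin n) K →ₗ[K] K)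
    (hfin : Module.Finite K (LinearMap.range (hankel Λ)))
    (hrank : Module.finrank K (LinearMap.range (hankel Λ)) = r)
    (hH : IsUnit ((Matrix.of fun i j =>
        Λ (monomial (α' i) (1 : K) * monomial (α j) 1)) : Matrix (Fin r) (Fin r) K))
    (p : MvPolynomial (Fin n) K) (hp : ∀ i, Λ (monomial (α' i) (1 : K) * p) = 0) :
    hankel Λ p = 0 := by
  obtain ⟨g, hg⟩ := exists_rep α α' Λ hfin hrank hH p
  have := coeff_zero α α' Λ hH g (fun i => by
    rw [mul_comm, ← hankel_app, ← hg, hankel_app, mul_comm, hp])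
  rw [hg, this]; simp

theorem hankel_mul_zero {K : Type*} [Field K] {n : ℕ}
    (Λ : MvPolynomial (Fin n) K →ₗ[K] K) (p q : MvPolynomial (Fin n) K)
    (h : hankel Λ p = 0) : hankel Λ (p * q) = 0 := by
  ext1 s
  ext
  simp only [LinearMap.comp_apply]
  rw [hankel_app, mul_assoc, ← hankel_app, h]; rfl

/-- uniqueness of the flat extension: two linear functionals on R that
agree on span(B'·B⁺), both of Hankel rank r with invertible matrices
(Λ(m'ᵢ·mⱼ)), coincide. -/
theorem flat_extension_unique {K : Type*} [Field K] {n r : ℕ}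
    (α α' : Fin r → (Fin n →₀ ℕ))
    (hα : Function.Injective α) (hα' : Function.Injective α')
    (hcα : ConnectedToOne α) (hcα' : ConnectedToOne α')
    (Λ₁ Λ₂ : MvPolynomial (Fin n) K →ₗ[K] K)
    (hagree : ∀ i j, Λ₁ (monomial (α' i) (1 : K) * monomial (α j) 1) =
        Λ₂ (monomial (α' i) (1 : K) * monomial (α j) 1))
    (hagree' : ∀ (l : Fin n) i j,
        Λ₁ (monomial (α' i) (1 : K) * (X l * monomial (α j) 1)) =
        Λ₂ (monomial (α' i) (1 : K) * (X l * monomial (α j) 1)))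
    (hfin₁ : Module.Finite K (LinearMap.range (hankel Λ₁)))
    (hrank₁ : Module.finrank K (LinearMap.range (hankel Λ₁)) = r)
    (hfin₂ : Module.Finite K (LinearMap.range (hankel Λ₂)))
    (hrank₂ : Module.finrank K (LinearMap.range (hankel Λ₂)) = r)
    (hH₁ : IsUnit ((Matrix.of fun i j =>
        Λ₁ (monomial (α' i) (1 : K) * monomial (α j) 1)) : Matrix (Fin r) (Fin r) K))
    (hH₂ : IsUnit ((Matrix.of fun i j =>
        Λ₂ (monomial (α' i) (1 : K) * monomial (α j) 1)) : Matrix (Fin r) (Fin r) K)) :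
    Λ₁ = Λ₂ := by
  by_cases hr : r = 0
  · have key : ∀ Λ : MvPolynomial (Fin n) K →ₗ[K] K,
        Module.Finite K (LinearMap.range (hankel Λ)) →
        Module.finrank K (LinearMap.range (hankel Λ)) = r → Λ = 0 := by
      intro Λ hf h
      rw [hr] at h
      have h1 := LinearMap.range_eq_bot.1 (Submodule.finrank_eq_zero.1 h)
      refine LinearMap.ext fun p => ?_
      rw [← one_mul p, ← hankel_app, h1]; rfl
    rw [key Λ₁ hfin₁ hrank₁, key Λ₂ hfin₂ hrank₂]
  obtain ⟨a, ha⟩ := conn_zero α hcα ⟨0, Nat.pos_of_ne_zero hr⟩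
  obtain ⟨b, hb⟩ := conn_zero α' hcα' ⟨0, Nat.pos_of_ne_zero hr⟩
  let S : Submodule K (MvPolynomial (Fin n) K) :=
    Submodule.span K (Set.range fun j => monomial (α j) (1 : K))
  let I := LinearMap.ker (hankel Λ₁) ⊓ LinearMap.ker (hankel Λ₂)
  have hX : ∀ l j, X l * monomial (α j) (1 : K) ∈ S ⊔ I := by
    intro l j
    obtain ⟨g, hg⟩ := exists_rep α α' Λ₁ hfin₁ hrank₁ hH₁ (X l * monomial (α j) (1 : K))
    rw [← sub_eq_zero, ← map_sub] at hg
    have hg2 : hankel Λ₂ (X l * monomial (α j) (1 : K) - ∑ j, g j • monomial (α j) (1 : K)) = 0 := by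
      apply ker_of_test α α' Λ₂ hfin₂ hrank₂ hH₂
      intro i
      have h1 : Λ₁ (monomial (α' i) (1 : K) *
          (X l * monomial (α j) (1 : K) - ∑ j, g j • monomial (α j) (1 : K))) = 0 := by
        rw [mul_comm, ← hankel_app, hg]; rfl
      rw [← h1]
      simp only [mul_sub, Finset.mul_sum, map_sub, map_sum, mul_smul_comm, map_smul,
        hagree, hagree']
    rw [← add_sub_cancel (∑ j, g j • monomial (α j) (1 : K)) (X l * monomial (α j) (1 : K))]
    refine Submodule.add_mem_sup ?_ ⟨hg, hg2⟩
    exact Submodule.sum_mem _ fun j _ => Submodule.smul_mem _ _ (Submodule.subset_span ⟨j, rfl⟩)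
  have hall : ∀ p, p ∈ S ⊔ I := by
    intro p
    induction p using MvPolynomial.induction_on with
    | C c =>
      apply Submodule.mem_sup_left
      have : (C c : MvPolynomial (Fin n) K) = c • monomial (α a) (1 : K) := by
        rw [ha, smul_monomial, smul_eq_mul, mul_one]; rfl
      rw [this]
      exact Submodule.smul_mem _ _ (Submodule.subset_span ⟨a, rfl⟩)
    | add p q hp hq => exact Submodule.add_mem _ hp hq
    | mul_X p l hp =>
      obtain ⟨s, hs, t, ht, rfl⟩ := Submodule.mem_sup.1 hp
      rw [add_mul]
      refine Submodule.add_mem _ ?_ (Submodule.mem_sup_right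
        ⟨hankel_mul_zero _ _ _ ht.1, hankel_mul_zero _ _ _ ht.2⟩)
      obtain ⟨g, rfl⟩ := (Submodule.mem_span_range_iff_exists_fun K).1 hs
      rw [Finset.sum_mul]
      refine Submodule.sum_mem _ fun j _ => ?_
      rw [smul_mul_assoc, mul_comm]
      exact Submodule.smul_mem _ _ (hX l j)
  refine LinearMap.ext fun p => ?_
  obtain ⟨s, hs, t, ht, rfl⟩ := Submodule.mem_sup.1 (hall p)
  have h1 : Λ₁ t = 0 := by
    have := ht.1
    rw [← mul_one t, ← hankel_app, LinearMap.mem_ker.1 ht.1]; rfl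
  have h2 : Λ₂ t = 0 := by
    rw [← mul_one t, ← hankel_app, LinearMap.mem_ker.1 ht.2]; rfl
  obtain ⟨g, rfl⟩ := (Submodule.mem_span_range_iff_exists_fun K).1 hs
  have hm : ∀ j, Λ₁ (monomial (α j) (1 : K)) = Λ₂ (monomial (α j) (1 : K)) := by
    intro j
    have := hagree b j
    rw [hb] at this
    simpa [monomial_mul] using this
  simp only [map_add, map_sum, map_smul, h1, h2, hm]
end

section
/- Let B = {m₁,…,m_r} and B' = {m'₁,…,m'_r} be two sets of r monomials in R = K[x₁,…,xₙ] and Λ a K-linear functional defined on the span of all products b'·b with b' ∈ B'⁺, b ∈ B⁺. Assume the matrix (Λ(b'·b))_{b'∈B'⁺, b∈B⁺} has rank r and that H := (Λ(m'_i·m_j))_{1≤i,j≤r} is invertible. Then the matrices M_l := H⁻¹·H_l, where H_l = (Λ(x_l·m'_i·m_j))_{1≤i,j≤r} for each variable x_l, pairwise commute. -/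
open MvPolynomial

/-- An enumeration of B⁺ = B ∪ x₁B ∪ ⋯ ∪ xₙB for the family of monomials with
exponents `α`: the index `(none, i)` gives mᵢ and `(some l, i)` gives xₗ·mᵢ. -/
noncomputable def bPlus {K : Type*} [Field K] {n r : ℕ} (α : Fin r → (Fin n →₀ ℕ)) :
    Option (Fin n) × Fin r → MvPolynomial (Fin n) K :=
  fun p => p.1.elim 1 X * monomial (α p.2) 1

theorem schur_aux {K ι : Type*} [Field K] [Fintype ι] [DecidableEq ι] {r : ℕ}
    (A : Matrix ι ι K) (hA : A.rank = r) (f g : Fin r → ι)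
    (hH : IsUnit (A.submatrix f g)) :
    A = A.submatrix id g * ((A.submatrix f g)⁻¹ * A.submatrix f id) := by
  have hmul : A.submatrix id g = A * (1 : Matrix ι ι K).submatrix id g := by
    ext i j
    simp [Matrix.mul_apply, Matrix.one_apply]
  have hmul2 : A.submatrix f g = (1 : Matrix ι ι K).submatrix f id * A.submatrix id g := by
    ext i j
    simp [Matrix.mul_apply, Matrix.one_apply]
  have hr : (A.submatrix id g).rank = r := by
    apply le_antisymm
    · rw [hmul]
      exact (Matrix.rank_mul_le_left _ _).trans hA.le
    · have h1 : (A.submatrix f g).rank = r := by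
        rw [Matrix.rank_of_isUnit _ hH]; simp
      rw [hmul2] at h1
      exact h1.symm.le.trans (Matrix.rank_mul_le_right _ _)
  have hle : LinearMap.range (A.submatrix id g).mulVecLin ≤ LinearMap.range A.mulVecLin := by
    rw [hmul, Matrix.mulVecLin_mul]
    exact LinearMap.range_comp_le_range _ _
  have heq := Submodule.eq_of_le_of_finrank_eq hle (hr.trans hA.symm)
  have hex : ∀ q, ∃ c : Fin r → K, (A.submatrix id g).mulVec c = A.col q := by
    intro q
    have : A.col q ∈ LinearMap.range A.mulVecLin := ⟨Pi.single q 1, by simp⟩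
    rw [← heq] at this
    exact this
  choose c hc using hex
  have hAC : A = A.submatrix id g * Matrix.of (fun j q => c q j) := by
    ext i q
    exact (congrFun (hc q) i).symm
  have hfC : A.submatrix f id = A.submatrix f g * Matrix.of (fun j q => c q j) := by
    ext i q
    exact congrFun (congrFun hAC (f i)) q
  rw [hfC, ← Matrix.mul_assoc (A.submatrix f g)⁻¹, Matrix.nonsing_inv_mul _ ((Matrix.isUnit_iff_isUnit_det _).1 hH),
    Matrix.one_mul]
  exact hAC

/-- if the matrix (Λ(b'·b))_{b'∈B'⁺, b∈B⁺} has rank r and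
H = (Λ(m'ᵢ·mⱼ)) is invertible, then the matrices M_l = H⁻¹·H_l, with
H_l = (Λ(xₗ·m'ᵢ·mⱼ)), pairwise commute. -/
theorem formal_multiplication_matrices_commute {K : Type*} [Field K] {n r : ℕ}
    (α α' : Fin r → (Fin n →₀ ℕ))
    (hα : Function.Injective α) (hα' : Function.Injective α')
    (Λ : MvPolynomial (Fin n) K →ₗ[K] K)
    (hrank : ((Matrix.of fun p q => Λ (bPlus α' p * bPlus α q)) :
        Matrix (Option (Fin n) × Fin r) (Option (Fin n) × Fin r) K).rank = r)
    (hH : IsUnit ((Matrix.of fun i j =>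
        Λ (monomial (α' i) (1 : K) * monomial (α j) 1)) :
        Matrix (Fin r) (Fin r) K)) :
    ∀ l l' : Fin n,
      (((Matrix.of fun i j => Λ (monomial (α' i) (1 : K) * monomial (α j) 1)) :
          Matrix (Fin r) (Fin r) K)⁻¹ *
       (Matrix.of fun i j =>
          Λ (X l * (monomial (α' i) (1 : K) * monomial (α j) 1)))) *
      (((Matrix.of fun i j => Λ (monomial (α' i) (1 : K) * monomial (α j) 1)) :
          Matrix (Fin r) (Fin r) K)⁻¹ *
       (Matrix.of fun i j =>
          Λ (X l' * (monomial (α' i) (1 : K) * monomial (α j) 1)))) =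
      (((Matrix.of fun i j => Λ (monomial (α' i) (1 : K) * monomial (α j) 1)) :
          Matrix (Fin r) (Fin r) K)⁻¹ *
       (Matrix.of fun i j =>
          Λ (X l' * (monomial (α' i) (1 : K) * monomial (α j) 1)))) *
      (((Matrix.of fun i j => Λ (monomial (α' i) (1 : K) * monomial (α j) 1)) :
          Matrix (Fin r) (Fin r) K)⁻¹ *
       (Matrix.of fun i j =>
          Λ (X l * (monomial (α' i) (1 : K) * monomial (α j) 1)))) := by
  intro l l'
  have key := schur_aux _ hrank (fun i => (none, i)) (fun i => (none, i))
    (by convert hH using 1; ext i j; simp [bPlus])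
  set A : Matrix (Option (Fin n) × Fin r) (Option (Fin n) × Fin r) K :=
    Matrix.of fun p q => Λ (bPlus α' p * bPlus α q) with hAdef
  set H : Matrix (Fin r) (Fin r) K :=
    Matrix.of fun i j => Λ (monomial (α' i) (1 : K) * monomial (α j) 1) with hHdef
  have hAH : A.submatrix (fun i : Fin r => (none, i)) (fun i : Fin r => (none, i)) = H := by
    ext i j; simp [hAdef, hHdef, bPlus]
  rw [hAH] at key
  let G : Fin n → Matrix (Fin r) (Fin r) K := fun l => Matrix.of fun i j =>
    Λ (X l * (monomial (α' i) (1 : K) * monomial (α j) 1))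
  have hL : ∀ l, (A.submatrix id (fun i : Fin r => (none, i))).submatrix
      (fun i : Fin r => (some l, i)) id = G l := by
    intro l; ext i j
    simp only [hAdef, G, bPlus, Matrix.submatrix_apply, Matrix.of_apply, id, Option.elim]
    congr 1; ring
  have hR : ∀ l, (A.submatrix (fun i : Fin r => (none, i)) id).submatrix id
      (fun i : Fin r => (some l, i)) = G l := by
    intro l; ext i j
    simp only [hAdef, G, bPlus, Matrix.submatrix_apply, Matrix.of_apply, id, Option.elim]
    congr 1; ring
  have hS : ∀ a b, A.submatrix (fun i : Fin r => (some a, i)) (fun i : Fin r => (some b, i))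
      = G a * (H⁻¹ * G b) := by
    intro a b
    rw [← hL a, ← hR b]
    ext i j
    exact congrFun (congrFun key (some a, i)) (some b, j)
  have hsym : G l * (H⁻¹ * G l') = G l' * (H⁻¹ * G l) := by
    rw [← hS, ← hS]
    ext i j
    simp only [hAdef, bPlus, Matrix.submatrix_apply, Matrix.of_apply, Option.elim]
    congr 1; ring
  change (H⁻¹ * G l) * (H⁻¹ * G l') = (H⁻¹ * G l') * (H⁻¹ * G l)
  rw [Matrix.mul_assoc, hsym, Matrix.mul_assoc]
end

section
/- Let H be an r×r matrix over a field K and let H⁺ be a block matrix of the form H⁺ = [[H, G'], [Gᵗ, J]], where G' is r×s', Gᵗ is s×r, and J is s×s'. Then rank(H⁺) = rank(H) if and only if there exist matrices W (of size r×s) and W' (of size r×s') such that G = Hᵗ·W, G' = H·W', and J = Wᵗ·H·W'. -/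
open Matrix

theorem aux_cols {K : Type*} [Field K] {m n p : Type*} [Fintype m] [Fintype n] [Fintype p]
    (A : Matrix m n K) (B : Matrix m p K) (h : (Matrix.fromCols A B).rank ≤ A.rank) :
    ∃ X : Matrix n p K, B = A * X := by
  classical
  have hle : LinearMap.range A.mulVecLin ≤ LinearMap.range (Matrix.fromCols A B).mulVecLin := by
    rintro _ ⟨v, rfl⟩
    refine ⟨Sum.elim v 0, ?_⟩
    simp [Matrix.fromCols_mulVec]
  have heq := Submodule.eq_of_le_of_finrank_le hle h
  have hx : ∀ j : p, ∃ v : n → K, A *ᵥ v = fun i => B i j := by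
    intro j
    have : (fun i => B i j) ∈ LinearMap.range A.mulVecLin := by
      rw [heq]
      refine ⟨Sum.elim 0 (Pi.single j 1), ?_⟩
      ext i
      simp [Matrix.fromCols_mulVec]
    obtain ⟨v, hv⟩ := this
    exact ⟨v, by simpa using hv⟩
  choose f hf using hx
  refine ⟨Matrix.of fun i j => f j i, ?_⟩
  ext i j
  have := congrFun (hf j) i
  rw [← this]
  simp [Matrix.mul_apply, Matrix.mulVec, dotProduct]

/-- a block matrix H⁺ = [[H, G'], [Gᵗ, J]] has the same rank as H iff
there exist W, W' with G = Hᵗ·W (i.e. Gᵗᵀ = Hᵀ·W), G' = H·W' and J = Wᵗ·H·W'. -/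
theorem block_matrix_rank_eq_iff {K : Type*} [Field K] {r s s' : ℕ}
    (H : Matrix (Fin r) (Fin r) K) (G' : Matrix (Fin r) (Fin s') K)
    (Gt : Matrix (Fin s) (Fin r) K) (J : Matrix (Fin s) (Fin s') K) :
    (Matrix.fromBlocks H G' Gt J).rank = H.rank ↔
      ∃ (W : Matrix (Fin r) (Fin s) K) (W' : Matrix (Fin r) (Fin s') K),
        Gtᵀ = Hᵀ * W ∧ G' = H * W' ∧ J = Wᵀ * H * W' := by
  have h1 : H.rank ≤ (Matrix.fromRows H Gt).rank :=
    Matrix.rank_submatrix_le (Matrix.fromRows H Gt) Sum.inl id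
  have h2 : (Matrix.fromRows H Gt).rank ≤ (Matrix.fromBlocks H G' Gt J).rank := by
    have e : Matrix.fromRows H Gt = (Matrix.fromBlocks H G' Gt J).submatrix id Sum.inl := by
      ext (i | i) j <;> rfl
    rw [e]
    exact Matrix.rank_submatrix_le _ _ _
  constructor
  · intro h
    have e : Matrix.fromBlocks H G' Gt J
        = Matrix.fromCols (Matrix.fromRows H Gt) (Matrix.fromRows G' J) := by
      ext (i | i) (j | j) <;> rfl
    obtain ⟨W', hW'⟩ := aux_cols (Matrix.fromRows H Gt) (Matrix.fromRows G' J)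
      (by rw [← e, h]; exact h1)
    obtain ⟨W, hW⟩ := aux_cols Hᵀ Gtᵀ (by
      rw [← Matrix.transpose_fromRows, Matrix.rank_transpose, Matrix.rank_transpose]
      exact h2.trans h.le)
    rw [Matrix.fromRows_mul] at hW'
    obtain ⟨ha, hb⟩ := Matrix.fromRows_inj hW'
    refine ⟨W, W', hW, ha, ?_⟩
    have hg : Gt = Wᵀ * H := by
      rw [← Matrix.transpose_transpose Gt, hW, Matrix.transpose_mul, Matrix.transpose_transpose]
    rw [← hg]
    exact hb
  · rintro ⟨W, W', hW, ha, hb⟩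
    refine le_antisymm ?_ (h1.trans h2)
    have hg : Gt = Wᵀ * H := by
      rw [← Matrix.transpose_transpose Gt, hW, Matrix.transpose_mul, Matrix.transpose_transpose]
    have e : Matrix.fromBlocks H G' Gt J
        = Matrix.fromRows 1 Wᵀ * (H * Matrix.fromCols 1 W') := by
      rw [Matrix.mul_fromCols, Matrix.fromRows_mul_fromCols, ha, hb, hg]
      simp [Matrix.mul_assoc]
    rw [e]
    exact (Matrix.rank_mul_le_right _ _).trans (Matrix.rank_mul_le_left _ _)
end
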